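/- Let θ = 1/4 and let n ∈ ℕ. For all σ, σ' in the open interval (2n+1, 2n+3), the languages of the corresponding piecewise rotations coincide: L(T_{1/4,σ}) = L(T_{1/4,σ'}). That is, for σ > 1 the symbolic dynamics depends only on the integer part of (σ-1)/2. -/

import Mathlib

/-- The piecewise rotation `T_{θ,σ}`:
`T_{θ,σ}(z) = e^{2πiθ}(z+σ+1)` if `Im z > 0` and `e^{2πiθ}(z+σ-1)` if `Im z < 0`
(points of the real axis are excluded from the dynamics). -/
noncomputable def pwRot (θ σ : ℝ) (z : ℂ) : ℂ :=
  if 0 < z.im then Complex.exp (2 * Real.pi * θ * Complex.I) * (z + σ + 1)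
  else Complex.exp (2 * Real.pi * θ * Complex.I) * (z + σ - 1)

/-- `z` has a well-defined orbit: it never hits the real axis. -/
def goodOrbit (θ σ : ℝ) (z : ℂ) : Prop := ∀ n : ℕ, ((pwRot θ σ)^[n] z).im ≠ 0

/-- The itinerary of `z`, with letters `1` and `2`. -/
noncomputable def itin (θ σ : ℝ) (z : ℂ) (n : ℕ) : ℕ :=
  if 0 < ((pwRot θ σ)^[n] z).im then 1 else 2

/-- The language of the piecewise rotation: finite words over `{1,2}` occurring as
factors of itineraries of points with well-defined orbit. -/
def lang (θ σ : ℝ) : Set (List ℕ) :=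
  {w | ∃ z : ℂ, goodOrbit θ σ z ∧ ∃ i : ℕ,
      w = (List.range w.length).map fun k => itin θ σ z (i + k)}

theorem pwRot_quarter (σ : ℝ) (z : ℂ) :
    pwRot (1/4) σ z = Complex.I * (if 0 < z.im then z + σ + 1 else z + σ - 1) := by
  have h : Complex.exp (2 * Real.pi * ((1/4 : ℝ) : ℂ) * Complex.I) = Complex.I := by
    refine Eq.trans ?_ Complex.exp_pi_div_two_mul_I
    congr 1
    push_cast
    ring
  rw [pwRot, h, mul_ite]

theorem pwRot_quarter_re (σ : ℝ) (z : ℂ) : (pwRot (1/4) σ z).re = -z.im := by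
  rw [pwRot_quarter]
  split_ifs <;> simp

theorem pwRot_quarter_im (σ : ℝ) (z : ℂ) :
    (pwRot (1/4) σ z).im = if 0 < z.im then z.re + σ + 1 else z.re + σ - 1 := by
  rw [pwRot_quarter]
  split_ifs <;> simp

/-- `y` and `y'` lie in the same cells of the partitions of the line cut out by the even integers
and by their images under the reflections `y ↦ σ + 1 - y` and `y' ↦ σ' + 1 - y'`; the point `y'`
is interior to its cells. -/
def SameCell (σ σ' y y' : ℝ) : Prop :=
  ∃ P Q : ℤ, (2 * P ≤ y ∧ y < 2 * P + 2) ∧ (2 * P < y' ∧ y' < 2 * P + 2) ∧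
    (2 * Q ≤ σ + 1 - y ∧ σ + 1 - y < 2 * Q + 2) ∧
    (2 * Q < σ' + 1 - y' ∧ σ' + 1 - y' < 2 * Q + 2)

namespace SameCell

variable {σ σ' y y' : ℝ}

theorem pos_iff (h : SameCell σ σ' y y') (hy : y ≠ 0) : 0 < y ↔ 0 < y' := by
  obtain ⟨P, Q, ⟨h1, h2⟩, ⟨h3, h4⟩, -⟩ := h
  rcases le_or_gt 0 P with hP | hP
  · have hP' : (0 : ℝ) ≤ P := by exact_mod_cast hP
    have : 0 < y := lt_of_le_of_ne (by linarith) hy.symm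
    exact ⟨fun _ => by linarith, fun _ => this⟩
  · have hP' : (P : ℝ) + 1 ≤ 0 := by exact_mod_cast hP
    constructor <;> intro <;> linarith

theorem ne_zero (h : SameCell σ σ' y y') : y' ≠ 0 := by
  obtain ⟨P, Q, -, ⟨h3, h4⟩, -⟩ := h
  rintro rfl
  have h5 : P < 0 := by
    have : (P : ℝ) < 0 := by linarith
    exact_mod_cast this
  have h6 : (P : ℝ) + 1 ≤ 0 := by exact_mod_cast h5
  linarith

theorem add_one_sub (h : SameCell σ σ' y y') : SameCell σ σ' (σ + 1 - y) (σ' + 1 - y') := by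
  obtain ⟨P, Q, hP, hP', hQ, hQ'⟩ := h
  exact ⟨Q, P, hQ, hQ', by simpa using hP, by simpa using hP'⟩

theorem sub_one_sub (h : SameCell σ σ' y y') : SameCell σ σ' (σ - 1 - y) (σ' - 1 - y') := by
  obtain ⟨P, Q, hP, hP', hQ, hQ'⟩ := h
  refine ⟨Q - 1, P + 1, ?_⟩
  push_cast
  refine ⟨⟨?_, ?_⟩, ⟨?_, ?_⟩, ⟨?_, ?_⟩, ?_, ?_⟩ <;> linarith

theorem exists_right {n : ℕ} (h1 : 2 * n + 1 < σ) (h2 : σ < 2 * n + 3)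
    (h1' : 2 * n + 1 < σ') (h2' : σ' < 2 * n + 3) (y : ℝ) : ∃ y', SameCell σ σ' y y' := by
  set P := ⌊y / 2⌋ with hP
  set Q := ⌊(σ + 1 - y) / 2⌋ with hQ
  have p1 : (P : ℝ) ≤ y / 2 := Int.floor_le _
  have p2 : y / 2 < P + 1 := Int.lt_floor_add_one _
  have q1 : (Q : ℝ) ≤ (σ + 1 - y) / 2 := Int.floor_le _
  have q2 : (σ + 1 - y) / 2 < Q + 1 := Int.lt_floor_add_one _
  have s1 : P + Q < n + 2 := by
    have : (P : ℝ) + Q < n + 2 := by linarith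
    exact_mod_cast this
  have s2 : (n : ℤ) + 1 < P + Q + 2 := by
    have : (n : ℝ) + 1 < P + Q + 2 := by linarith
    exact_mod_cast this
  have s3 : (P : ℝ) + Q ≤ n + 1 := by
    have : P + Q ≤ (n : ℤ) + 1 := by omega
    exact_mod_cast this
  have s4 : (n : ℝ) ≤ P + Q := by
    have : (n : ℤ) ≤ P + Q := by omega
    exact_mod_cast this
  refine ⟨2 * P + (σ' + 1 - 2 * (P + Q)) / 2, P, Q, ?_⟩
  refine ⟨⟨?_, ?_⟩, ⟨?_, ?_⟩, ⟨?_, ?_⟩, ?_, ?_⟩ <;> linarith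

end SameCell

theorem sameCell_iterate {σ σ' : ℝ} {z z' : ℂ} (hz : goodOrbit (1/4) σ z)
    (hre : SameCell σ σ' (-z.re) (-z'.re)) (him : SameCell σ σ' z.im z'.im) (k : ℕ) :
    SameCell σ σ' (-((pwRot (1/4) σ)^[k] z).re) (-((pwRot (1/4) σ')^[k] z').re) ∧
      SameCell σ σ' ((pwRot (1/4) σ)^[k] z).im ((pwRot (1/4) σ')^[k] z').im := by
  induction k with
  | zero => exact ⟨hre, him⟩
  | succ k ih =>
    obtain ⟨ihre, ihim⟩ := ih
    have hpos := ihim.pos_iff (hz k)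
    simp only [Function.iterate_succ_apply', pwRot_quarter_re, pwRot_quarter_im, neg_neg]
    refine ⟨ihim, ?_⟩
    by_cases h : 0 < ((pwRot (1/4) σ)^[k] z).im
    · rw [if_pos h, if_pos (hpos.1 h)]
      convert ihre.add_one_sub using 1 <;> ring
    · rw [if_neg h, if_neg (mt hpos.2 h)]
      convert ihre.sub_one_sub using 1 <;> ring

theorem lang_quarter_subset {n : ℕ} {σ σ' : ℝ}
    (h1 : 2 * n + 1 < σ) (h2 : σ < 2 * n + 3)
    (h1' : 2 * n + 1 < σ') (h2' : σ' < 2 * n + 3) :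
    lang (1/4) σ ⊆ lang (1/4) σ' := by
  rintro w ⟨z, hz, i, hw⟩
  obtain ⟨x, hx⟩ := SameCell.exists_right h1 h2 h1' h2' (-z.re)
  obtain ⟨y, hy⟩ := SameCell.exists_right h1 h2 h1' h2' z.im
  have key := sameCell_iterate (z' := ⟨-x, y⟩) hz (by simpa using hx) hy
  have hit : itin (1/4) σ z = itin (1/4) σ' ⟨-x, y⟩ := by
    funext k
    simp only [itin, (key k).2.pos_iff (hz k)]
  exact ⟨⟨-x, y⟩, fun k => (key k).2.ne_zero, i, hit ▸ hw⟩

/-- For `θ = 1/4` and `σ, σ'` in the same interval `(2n+1, 2n+3)`, the languages of the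
corresponding piecewise rotations coincide: for `σ > 1` the symbolic dynamics depends
only on the integer part of `(σ-1)/2`. -/
theorem stmt_10 (n : ℕ) (σ σ' : ℝ)
    (h1 : 2 * n + 1 < σ) (h2 : σ < 2 * n + 3)
    (h1' : 2 * n + 1 < σ') (h2' : σ' < 2 * n + 3) :
    lang (1/4) σ = lang (1/4) σ' :=
  (lang_quarter_subset h1 h2 h1' h2').antisymm (lang_quarter_subset h1' h2' h1 h2)
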